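/- Let d be a positive integer such that d·(2^l + 1) ≡ 2^i (mod 2^n − 1) for some nonnegative integer i. Then for every τ with 0 ≤ τ ≤ 2^n − 2, C_d(τ) ∈ {−1, −1 + 2^n, −1 − 2^n, −1 − 2^{n+k}}, and the counts of occurrences satisfy: #{τ : C_d(τ) = −1} = 2^{n−k} − 1; (2^k + 1)·#{τ : C_d(τ) = −1 + 2^n} = 2^{k−1}·(2^n + 1); (2^k − 1)·#{τ : C_d(τ) = −1 − 2^n} = (2^{k−1} − 1)·(2^n − 1); and (2^{2k} − 1)·#{τ : C_d(τ) = −1 − 2^{n+k}} = 2^{n−k} − 1. In particular, the value −1 + 2^{n+k} never occurs. -/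

import Mathlib

open Finset

-- For `v` in the prime subfield `{0,1}` of `F`, `sgnF v` is the integer `(−1)^v`:
-- `1` if `v = 0` and `−1` if `v = 1`.
open Classical in
noncomputable def sgnF {F : Type*} [Zero F] (v : F) : ℤ :=
  if v = 0 then 1 else -1

-- `trF j x = Σ_{i=0}^{j−1} x^(2^i)`.
def trF {F : Type*} [Field F] (j : ℕ) (x : F) : F :=
  ∑ i ∈ Finset.range j, x ^ 2 ^ i

-- The cross correlation `C_d(τ) = Σ_{t=0}^{2^m−2} (−1)^{s_t + u_{d(t+τ)}}` between the
-- `m`-sequence `s_t = tr_m(α^t)` of period `2^m−1` and the `d`-decimation of the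
-- `m`-sequence `u_t = tr_n(β^t)` of period `2^n−1`, where `β = α^(2^n+1)`.
noncomputable def crossCorr {F : Type*} [Field F] (m n d : ℕ) (α : F) (τ : ℕ) : ℤ :=
  ∑ t ∈ Finset.range (2 ^ m - 1),
    sgnF (trF m (α ^ t) + trF n ((α ^ (2 ^ n + 1)) ^ (d * (t + τ))))

/-- A finite field of characteristic two with two commuting automorphisms `σ` and `bar`, where `bar`
is an involution, such that `σ ∘ bar` has odd order `r` modulo `bar`, together with a nontrivial
additive character that both automorphisms preserve. -/
structure FormData (F : Type*) [Field F] [CharP F 2] where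
  σ : F →+* F
  bar : F →+* F
  ψ : AddChar F ℤ
  ω : F
  r : ℕ
  bar_bar : ∀ x, bar (bar x) = x
  σ_bar : ∀ x, σ (bar x) = bar (σ x)
  σ_ω : σ ω = ω
  bar_ω : bar ω = ω + 1
  g_inj : ∀ x y, x * σ x = y * σ y → x = y
  r_odd : Odd r
  theta_iter : ∀ x, (fun z => σ (bar z))^[r] x = bar x
  ψ_σ : ∀ x, ψ (σ x) = ψ x
  ψ_bar : ∀ x, ψ (bar x) = ψ x
  ψ_ne : ψ ≠ 1

namespace FormData

section

open scoped Classical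

variable {F : Type*} [Field F] [CharP F 2] (D : FormData F)

/-- The automorphism `σ ∘ bar`. -/
def θ : F →+* F := D.σ.comp D.bar

lemma θ_apply (x : F) : D.θ x = D.σ (D.bar x) := rfl

lemma θ_bar (x : F) : D.θ (D.bar x) = D.σ x := by rw [θ_apply, D.bar_bar]

lemma bar_θ (x : F) : D.bar (D.θ x) = D.σ x := by rw [θ_apply, D.σ_bar, D.bar_bar]

lemma θ_θ (x : F) : D.θ (D.θ x) = D.σ (D.σ x) := by
  rw [θ_apply, bar_θ]

lemma θ_iter (x : F) : D.θ^[D.r] x = D.bar x := D.theta_iter x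

lemma bar_eq_of_θ_eq {x : F} (h : D.θ x = x) : D.bar x = x := by
  rw [← D.θ_iter, Function.iterate_fixed h]

lemma θ_ω : D.θ D.ω = D.ω + 1 := by
  rw [θ_apply, D.bar_ω, map_add, D.σ_ω, map_one]

/-- The radical equation `θ²x + Bθx + x = 0`. -/
def IsRad (B x : F) : Prop := D.θ (D.θ x) + B * D.θ x + x = 0

/-- The Wronskian of two elements. -/
def wr (x z : F) : F := x * D.θ z - z * D.θ x

lemma θ_wr {B x z : F} (hx : D.IsRad B x) (hz : D.IsRad B z) :
    D.θ (D.wr x z) = D.wr x z := by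
  simp only [wr, IsRad, map_sub, map_mul] at *
  linear_combination D.θ x * hz - D.θ z * hx

lemma IsRad.mul_add_mul {B x z c e : F} (hx : D.IsRad B x) (hz : D.IsRad B z)
    (hc : D.θ c = c) (he : D.θ e = e) : D.IsRad B (c * x + e * z) := by
  simp only [IsRad, map_add, map_mul, hc, he] at *
  linear_combination c * hx + e * hz

lemma exists_coboundary {κ : F} (hκ : D.bar κ = κ) : ∃ u, D.θ u = u + κ := by
  obtain ⟨t, ht⟩ := D.r_odd
  have key : ∀ t : ℕ, ∃ e : F, ∑ j ∈ range (2 * t + 1), D.θ^[j] κ = κ + e + D.θ e ∧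
      D.bar e = e := by
    intro t
    induction t with
    | zero => exact ⟨0, by simp⟩
    | succ t ih =>
      obtain ⟨e, he, he'⟩ := ih
      refine ⟨e + D.θ^[2 * t + 1] κ, ?_, ?_⟩
      · rw [show 2 * (t + 1) + 1 = 2 * t + 1 + 1 + 1 by ring, sum_range_succ, sum_range_succ, he,
          map_add, Function.iterate_succ_apply' D.θ (2 * t + 1)]
        ring
      · rw [map_add, he', ← D.θ_iter, ← Function.iterate_add_apply, add_comm D.r,
          Function.iterate_add_apply, D.θ_iter, hκ]
  obtain ⟨e, he, -⟩ := key t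
  rw [← ht] at he
  set a := ∑ j ∈ range D.r, D.θ^[j] κ with ha
  have hθa : D.θ a = a := by
    have h1 := sum_range_succ' (fun j => D.θ^[j] κ) D.r
    rw [sum_range_succ, D.θ_iter, hκ] at h1
    rw [ha, map_sum]
    simp only [Function.iterate_succ_apply', Function.iterate_zero, id] at h1
    exact (add_right_cancel h1).symm
  refine ⟨D.ω * a + e, ?_⟩
  rw [map_add, map_mul, hθa, θ_ω]
  grind

lemma exists_wr_ne_zero {B y : F} (hB : D.bar B = B) (hy : D.IsRad B y) (hy0 : y ≠ 0) :
    ∃ z, D.IsRad B z ∧ D.wr y z ≠ 0 := by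
  by_cases hby : D.bar y = y
  · have hθy : D.θ y ≠ 0 := (map_ne_zero _).2 hy0
    obtain ⟨u, hu⟩ := D.exists_coboundary (κ := (y * D.θ y)⁻¹)
      (by rw [map_inv₀, map_mul, hby, bar_θ, θ_apply, hby])
    have hw : D.wr y (y * u) = 1 := by
      rw [wr, map_mul, hu]
      field_simp
      ring
    refine ⟨y * u, ?_, by rw [hw]; exact one_ne_zero⟩
    have h1 : D.θ (D.wr y (y * u)) = D.wr y (y * u) := by rw [hw, map_one]
    apply (mul_eq_zero.1 (?_ : D.θ y * _ = 0)).resolve_left hθy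
    simp only [wr, IsRad, map_sub, map_mul] at *
    linear_combination h1 + D.θ y * D.θ u * hy
  · refine ⟨D.bar y, ?_, fun h => hby ?_⟩
    · have := congrArg D.bar hy
      rw [map_add, map_add, map_mul, hB, map_zero] at this
      have h2 : ∀ x, D.bar (D.θ x) = D.θ (D.bar x) := fun x => by rw [bar_θ, θ_bar]
      rwa [h2, h2] at this
    · apply D.g_inj
      rw [wr, θ_bar, θ_apply] at h
      linear_combination -h

variable [Fintype F]

/-- The fixed field of `θ`. -/
noncomputable def E : Finset F := univ.filter fun x => D.θ x = x

/-- The fixed field of `bar`. -/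
noncomputable def K : Finset F := univ.filter fun x => D.bar x = x

lemma mem_K {x : F} : x ∈ D.K ↔ D.bar x = x := by simp [K]

lemma mem_E {x : F} : x ∈ D.E ↔ D.θ x = x := by simp [E]

/-- The radical for the parameter `B`. -/
noncomputable def rad (B : F) : Finset F := univ.filter (D.IsRad B)

lemma mem_rad {B x : F} : x ∈ D.rad B ↔ D.IsRad B x := by simp [rad]

lemma card_rad {B y : F} (hB : D.bar B = B) (hy : D.IsRad B y) (hy0 : y ≠ 0) :
    #(D.rad B) = #D.E ^ 2 := by
  obtain ⟨z, hz, hw⟩ := D.exists_wr_ne_zero hB hy hy0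
  have hwE := D.θ_wr hy hz
  rw [sq, ← card_product]
  refine card_nbij' (fun x => (D.wr x z / D.wr y z, D.wr y x / D.wr y z))
    (fun p => p.1 * y + p.2 * z) ?_ ?_ ?_ ?_
  · intro x hx
    have hx := D.mem_rad.1 hx
    simp only [coe_product, Set.mem_prod, mem_coe, mem_E, map_div₀, hwE, D.θ_wr hx hz,
      D.θ_wr hy hx, and_self]
  · rintro ⟨c, e⟩ hp
    simp only [coe_product, Set.mem_prod, mem_coe, mem_E] at hp
    exact D.mem_rad.2 (IsRad.mul_add_mul D hy hz hp.1 hp.2)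
  · intro x _
    simp only
    field_simp
    simp only [wr]
    ring
  · rintro ⟨c, e⟩ hp
    simp only [coe_product, Set.mem_prod, mem_coe, mem_E] at hp
    ext
    · simp only
      rw [div_eq_iff hw]
      simp only [wr, map_add, map_mul, hp.1, hp.2]
      ring
    · simp only
      rw [div_eq_iff hw]
      simp only [wr, map_add, map_mul, hp.1, hp.2]
      ring

lemma g_surj (x : F) : ∃ y, y * D.σ y = x :=
  Finite.injective_iff_surjective.1 (fun x y h => D.g_inj x y h :
    Function.Injective fun y => y * D.σ y) x

lemma card_add_bar_mem_E : #{x | x + D.bar x ∈ D.E} = #D.K * #D.E := by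
  rw [← card_product]
  refine card_nbij' (fun x => (x + D.ω * (x + D.bar x), x + D.bar x))
    (fun p => p.1 + D.ω * p.2) ?_ ?_ ?_ ?_
  · intro x hx
    simp only [coe_product, Set.mem_prod, mem_coe, mem_K, mem_filter_univ] at *
    refine ⟨?_, hx⟩
    simp only [map_add, map_mul, D.bar_bar, D.bar_ω]
    grind
  · rintro ⟨c, e⟩ hp
    simp only [coe_product, Set.mem_prod, mem_coe, mem_K, mem_filter_univ] at *
    obtain ⟨hc, he⟩ := hp
    convert he using 1
    simp only [map_add, map_mul, D.bar_ω, hc, D.bar_eq_of_θ_eq (D.mem_E.1 he)]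
    grind
  · intro x _
    simp only
    grind
  · rintro ⟨c, e⟩ hp
    simp only [coe_product, Set.mem_prod, mem_coe, mem_K] at *
    obtain ⟨hc, he⟩ := hp
    have h2 := D.bar_eq_of_θ_eq (D.mem_E.1 he)
    ext <;> simp only [map_add, map_mul, D.bar_ω, hc, h2] <;> grind

/-- A nonzero element is radical for a parameter in `K` exactly when the trace of its image under
`y ↦ yσ(y)` is in `E`, and then for a unique parameter. -/
lemma sum_card_rad_erase :
    ∑ b ∈ D.K, #((D.rad (D.σ b)).erase 0) + 1 = #D.K * #D.E := by
  have h1 : #{y | y * D.σ y + D.bar (y * D.σ y) ∈ D.E} = #D.K * #D.E := by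
    rw [← card_add_bar_mem_E]
    refine card_nbij (fun y => y * D.σ y) ?_ ?_ ?_
    · intro y hy
      simpa using hy
    · intro x _ y _ h
      exact D.g_inj x y h
    · intro x hx
      obtain ⟨y, rfl⟩ := D.g_surj x
      exact ⟨y, by simpa using hx, rfl⟩
  rw [← h1, ← card_erase_add_one (a := (0 : F)) (by simp [mem_E]), ← card_sigma]
  congr 1
  have hσinj : Function.Injective D.σ := D.σ.injective
  refine card_nbij (fun p => p.2) ?_ ?_ ?_
  · rintro ⟨b, y⟩ hp
    simp only [mem_coe, mem_sigma, mem_erase, mem_rad, mem_K, mem_filter_univ, mem_E] at *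
    obtain ⟨hb, hy0, hy⟩ := hp
    refine ⟨hy0, ?_⟩
    have hy' : D.IsRad (D.σ b) (D.bar y) := by
      have := congrArg D.bar hy
      have h2 : ∀ x, D.bar (D.θ x) = D.θ (D.bar x) := fun x => by rw [bar_θ, θ_bar]
      rwa [map_add, map_add, map_mul, ← D.σ_bar, hb, map_zero, h2, h2] at this
    have h3 := D.θ_wr hy hy'
    have h4 : D.wr y (D.bar y) = y * D.σ y + D.bar (y * D.σ y) := by
      rw [wr, θ_bar, map_mul, θ_apply, D.σ_bar, CharTwo.sub_eq_add]
    rwa [h4] at h3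
  · rintro ⟨b, y⟩ hp ⟨b', y'⟩ hp' h
    simp only [mem_coe, mem_sigma, mem_erase, mem_rad] at *
    subst h
    have : D.σ b * D.θ y = D.σ b' * D.θ y := by
      have h1 := hp.2.2
      have h2 := hp'.2.2
      simp only [IsRad] at h1 h2
      linear_combination h1 - h2
    have := hσinj (mul_right_cancel₀ ((map_ne_zero _).2 hp.2.1) this)
    rw [this]
  · intro y hy
    simp only [mem_coe, mem_erase, mem_filter_univ, mem_E] at hy
    obtain ⟨hy0, hy⟩ := hy
    have hθy : D.θ y ≠ 0 := (map_ne_zero _).2 hy0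
    obtain ⟨b, hb⟩ := Finite.injective_iff_surjective.1 hσinj ((D.θ (D.θ y) + y) / D.θ y)
    refine ⟨⟨b, y⟩, ?_, rfl⟩
    simp only [mem_coe, mem_sigma, mem_erase, mem_rad, mem_K]
    refine ⟨hσinj ?_, hy0, ?_⟩
    · rw [D.σ_bar, hb, map_div₀, map_add, bar_θ, bar_θ]
      have hσy : D.σ y ≠ 0 := (map_ne_zero _).2 hy0
      rw [div_eq_div_iff hσy hθy]
      simp only [map_add, map_mul, θ_apply, D.bar_bar, D.σ_bar] at *
      grind
    · rw [IsRad, hb, div_mul_cancel₀ _ hθy]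
      grind

omit [Fintype F] in
lemma ψ_sq (x : F) : D.ψ x ^ 2 = 1 := by
  rw [sq, ← AddChar.map_add_eq_mul, CharTwo.add_self_eq_zero, AddChar.map_zero_eq_one]

omit [Fintype F] in
lemma ψ_sum {ι : Type*} (s : Finset ι) (f : ι → F) :
    D.ψ (∑ i ∈ s, f i) = ∏ i ∈ s, D.ψ (f i) := by
  induction s using Finset.induction_on with
  | empty => simp
  | insert i s hi ih => rw [sum_insert hi, prod_insert hi, AddChar.map_add_eq_mul, ih]

lemma sum_ψ (c : F) : ∑ y, D.ψ (y * c) = if c = 0 then (Fintype.card F : ℤ) else 0 := by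
  rw [AddChar.sum_mulShift c (AddChar.IsPrimitive.of_ne_one D.ψ_ne)]
  split_ifs <;> simp

lemma exists_ψ_ω_ne : ∃ b, D.bar b = b ∧ D.ψ (D.ω * b) ≠ 1 := by
  by_contra! h
  refine D.ψ_ne (DFunLike.ext _ _ fun x => ?_)
  have h1 := h (x + D.bar x) (by rw [map_add, D.bar_bar, add_comm])
  have h2 : D.ψ (D.ω * D.bar x) = D.ψ (D.ω * x) * D.ψ x := by
    rw [← D.ψ_bar, map_mul, D.bar_bar, D.bar_ω, add_mul, one_mul, AddChar.map_add_eq_mul]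
  rw [mul_add, AddChar.map_add_eq_mul, h2, ← mul_assoc, ← sq, ψ_sq, one_mul] at h1
  rw [h1, AddChar.one_apply]

lemma sum_K_ψ {κ : F} (hκ : D.bar κ = κ) :
    ∑ b ∈ D.K, D.ψ (D.ω * b * κ) = if κ = 0 then (#D.K : ℤ) else 0 := by
  split_ifs with h0
  · simp [h0]
  obtain ⟨b₀, hb₀, hne⟩ := D.exists_ψ_ω_ne
  have hshift : ∑ b ∈ D.K, D.ψ (D.ω * b * κ) =
      D.ψ (D.ω * b₀) * ∑ b ∈ D.K, D.ψ (D.ω * b * κ) := by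
    rw [mul_sum]
    refine sum_nbij' (fun b => b - b₀ / κ) (fun b => b + b₀ / κ) ?_ ?_ ?_ ?_ ?_
    · intro b hb
      rw [mem_K] at *
      rw [map_sub, map_div₀, hb, hb₀, hκ]
    · intro b hb
      rw [mem_K] at *
      rw [map_add, map_div₀, hb, hb₀, hκ]
    · intro b _; ring
    · intro b _; ring
    · intro b _
      rw [← AddChar.map_add_eq_mul]
      congr 1
      field_simp
      ring
  have : (D.ψ (D.ω * b₀) - 1) * ∑ b ∈ D.K, D.ψ (D.ω * b * κ) = 0 := by
    linear_combination -hshift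
  exact (mul_eq_zero.1 this).resolve_left (sub_ne_zero.2 hne)

/-- The quadratic form `y σ(y) + ω b y bar(y)`. -/
def form (b y : F) : F := y * D.σ y + D.ω * b * (y * D.bar y)

/-- The exponential sum of `a y σ(y) + ω b y bar(y)`. -/
noncomputable def S (a b : F) : ℤ := ∑ y, D.ψ (a * (y * D.σ y) + D.ω * b * (y * D.bar y))

lemma sum_sum_S_pow (j : ℕ) :
    ∑ a, ∑ b ∈ D.K, D.S a b ^ j = Fintype.card F * #D.K *
      #{v : Fin j → F | ∑ i, v i * D.σ (v i) = 0 ∧ ∑ i, v i * D.bar (v i) = 0} := by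
  have hS : ∀ a b, D.S a b ^ j = ∑ v : Fin j → F,
      D.ψ ((∑ i, v i * D.σ (v i)) * a) * D.ψ (D.ω * b * ∑ i, v i * D.bar (v i)) := by
    intro a b
    rw [S, Fintype.sum_pow]
    refine sum_congr rfl fun v _ => ?_
    rw [← AddChar.map_add_eq_mul, sum_mul, mul_sum, ← sum_add_distrib, ψ_sum]
    simp only [mul_comm a]
  have hN : ∀ v : Fin j → F, D.bar (∑ i, v i * D.bar (v i)) = ∑ i, v i * D.bar (v i) := by
    intro v
    simp only [map_sum, map_mul, D.bar_bar, mul_comm]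
  calc ∑ a, ∑ b ∈ D.K, D.S a b ^ j
      = ∑ v : Fin j → F, (∑ a, D.ψ (a * ∑ i, v i * D.σ (v i))) *
          ∑ b ∈ D.K, D.ψ (D.ω * b * ∑ i, v i * D.bar (v i)) := by
        simp only [hS, sum_mul_sum]
        rw [sum_comm (s := univ (α := Fin j → F))]
        refine sum_congr rfl fun a _ => ?_
        rw [sum_comm]
        simp only [mul_comm a]
    _ = ∑ v : Fin j → F, if ∑ i, v i * D.σ (v i) = 0 ∧ ∑ i, v i * D.bar (v i) = 0 then
          (Fintype.card F * #D.K : ℤ) else 0 := by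
        refine sum_congr rfl fun v _ => ?_
        rw [sum_ψ, sum_K_ψ D (hN v), ite_and]
        split_ifs <;> simp
    _ = _ := by
        rw [← sum_filter, sum_const, nsmul_eq_mul, mul_comm]

lemma S_scale {c : F} (hc : c ≠ 0) (a b : F) :
    D.S (a * (c * D.σ c)) (b * (c * D.bar c)) = D.S a b := by
  refine Fintype.sum_equiv (Equiv.mulLeft₀ c hc) _ _ fun y => ?_
  simp only [Equiv.mulLeft₀_apply, map_mul]
  congr 1
  ring

lemma sum_S_pow_eq {a : F} (ha : a ≠ 0) (j : ℕ) :
    ∑ b ∈ D.K, D.S a b ^ j = ∑ b ∈ D.K, D.S 1 b ^ j := by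
  obtain ⟨c, rfl⟩ := D.g_surj a
  have hc : c ≠ 0 := left_ne_zero_of_mul ha
  have hc' : D.bar c ≠ 0 := (map_ne_zero _).2 hc
  symm
  have hN : D.bar (c * D.bar c) = c * D.bar c := by rw [map_mul, D.bar_bar, mul_comm]
  refine sum_nbij' (fun b => b * (c * D.bar c)) (fun b => b / (c * D.bar c)) ?_ ?_ ?_ ?_ ?_
  · intro b hb
    rw [mem_K] at *
    rw [map_mul, hN, hb]
  · intro b hb
    rw [mem_K] at *
    rw [map_div₀, hN, hb]
  · intro b _; field_simp
  · intro b _; field_simp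
  · intro b _
    rw [← D.S_scale hc 1 b, one_mul]

lemma S_zero_zero : D.S 0 0 = Fintype.card F := by
  simp [S]

lemma S_zero_eq {b : F} (hb : D.bar b = b) (hb0 : b ≠ 0) : D.S 0 b = D.S 0 1 := by
  obtain ⟨c, hc⟩ := (frobenius_inj F 2 |> Finite.injective_iff_surjective.1) b
  rw [frobenius_def] at hc
  have hc0 : c ≠ 0 := by
    rintro rfl
    exact hb0 (by rw [← hc]; ring)
  have hcK : D.bar c = c := by
    apply frobenius_inj F 2
    rw [frobenius_def, frobenius_def, ← map_pow, hc, hb]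
  rw [← D.S_scale hc0 0 1, zero_mul, one_mul, hcK, ← sq, hc]

lemma zero_mem_K : (0 : F) ∈ D.K := by rw [mem_K, map_zero]

lemma sum_S_zero_pow (j : ℕ) :
    ∑ b ∈ D.K, D.S 0 b ^ j = (Fintype.card F : ℤ) ^ j + (#D.K - 1) * D.S 0 1 ^ j := by
  rw [← add_sum_erase _ _ D.zero_mem_K, S_zero_zero, sum_congr rfl
    (g := fun _ => D.S 0 1 ^ j), sum_const, card_erase_of_mem D.zero_mem_K, nsmul_eq_mul,
    Nat.cast_sub (card_pos.2 ⟨_, D.zero_mem_K⟩), Nat.cast_one]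
  intro b hb
  rw [D.S_zero_eq (D.mem_K.1 (mem_of_mem_erase hb)) (ne_of_mem_erase hb)]

lemma moment (j : ℕ) :
    (Fintype.card F - 1) * ∑ b ∈ D.K, D.S 1 b ^ j
      + ((Fintype.card F : ℤ) ^ j + (#D.K - 1) * D.S 0 1 ^ j) = Fintype.card F * #D.K *
      #{v : Fin j → F | ∑ i, v i * D.σ (v i) = 0 ∧ ∑ i, v i * D.bar (v i) = 0} := by
  rw [← sum_sum_S_pow, ← sum_S_zero_pow, ← add_sum_erase _ _ (mem_univ (0 : F)), add_comm,
    sum_congr rfl (s₁ := univ.erase (0 : F)) (g := fun _ => ∑ b ∈ D.K, D.S 1 b ^ j)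
    (fun a ha => D.sum_S_pow_eq (ne_of_mem_erase ha) j), sum_const,
    card_erase_of_mem (mem_univ _), nsmul_eq_mul, card_univ, Nat.cast_sub Fintype.card_pos,
    Nat.cast_one]

lemma S_zero_one (h2 : 1 < #D.K) (hF : Fintype.card F = #D.K ^ 2) : D.S 0 1 = -#D.K := by
  have h1 : ∑ b ∈ D.K, D.S 0 b = #D.K := by
    simp only [S]
    rw [sum_comm]
    have : ∀ y : F, ∑ b ∈ D.K, D.ψ (0 * (y * D.σ y) + D.ω * b * (y * D.bar y)) =
        if y = 0 then (#D.K : ℤ) else 0 := by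
      intro y
      simp only [zero_mul, zero_add]
      rw [D.sum_K_ψ (by rw [map_mul, D.bar_bar, mul_comm])]
      simp
    rw [sum_congr rfl fun y _ => this y, sum_ite_eq', if_pos (mem_univ _)]
  have h3 := D.sum_S_zero_pow 1
  simp only [pow_one] at h3
  rw [h1, hF] at h3
  push_cast at h3
  have h4 : ((#D.K : ℤ) - 1) ≠ 0 := by
    have : (1 : ℤ) < #D.K := by exact_mod_cast h2
    omega
  apply mul_left_cancel₀ h4
  linear_combination -h3

lemma card_one : #{v : Fin 1 → F | ∑ i, v i * D.σ (v i) = 0 ∧ ∑ i, v i * D.bar (v i) = 0} = 1 := by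
  rw [card_eq_one]
  refine ⟨0, ?_⟩
  ext v
  simp [funext_iff]

lemma card_two : #{v : Fin 2 → F | ∑ i, v i * D.σ (v i) = 0 ∧ ∑ i, v i * D.bar (v i) = 0} =
    Fintype.card F := by
  rw [← card_univ]
  refine card_nbij' (fun v => v 0) (fun x => ![x, x]) ?_ ?_ ?_ ?_
  · intro v _; simp
  · intro x _
    simp [CharTwo.add_self_eq_zero]
  · intro v hv
    simp only [mem_coe, mem_filter_univ, Fin.sum_univ_two] at hv
    have := D.g_inj _ _ (CharTwo.add_eq_zero.1 hv.1)
    ext i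
    fin_cases i <;> simp [this]
  · intro x _; simp

omit [Fintype F] in
lemma norm_add_iff {x y z : F} (h : x * D.σ x + y * D.σ y + z * D.σ z = 0) :
    x * D.bar x + y * D.bar y + z * D.bar z = 0 ↔ x * D.θ y = y * D.θ x := by
  have hp : (x * D.bar x + y * D.bar y) * D.σ (x * D.bar x + y * D.bar y) =
      z * D.bar z * D.σ (z * D.bar z) +
        (x * D.θ y + y * D.θ x) * D.bar (x * D.θ y + y * D.θ x) := by
    have h1 : z * D.σ z = x * D.σ x + y * D.σ y := by grind
    have h2 := congrArg D.bar h1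
    have h3 : z * D.bar z * D.σ (z * D.bar z) = z * D.σ z * D.bar (z * D.σ z) := by
      simp only [map_mul, D.σ_bar]; ring
    rw [h3, h1]
    simp only [map_add, map_mul, D.θ_apply, D.σ_bar, D.bar_bar]
    grind
  have e1 : x * D.bar x + y * D.bar y + z * D.bar z = 0 ↔
      x * D.bar x + y * D.bar y = z * D.bar z := CharTwo.add_eq_zero
  have e2 : x * D.θ y = y * D.θ x ↔ x * D.θ y + y * D.θ x = 0 := CharTwo.add_eq_zero.symm
  rw [e1, e2]
  constructor
  · intro h4
    rw [h4] at hp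
    have h5 := left_eq_add.1 hp
    rcases mul_eq_zero.1 h5 with h | h
    · exact h
    · exact (map_eq_zero _).1 h
  · intro h4
    rw [h4, zero_mul, add_zero] at hp
    exact D.g_inj _ _ hp

lemma card_parallel (y : F) : #{x | x * D.θ y = y * D.θ x} =
    if y = 0 then Fintype.card F else #D.E := by
  split_ifs with h
  · simp [h]
  have hy : D.θ y ≠ 0 := (map_ne_zero _).2 h
  refine card_nbij' (fun x => x / y) (fun e => e * y) ?_ ?_ ?_ ?_
  · intro x hx
    simp only [mem_coe, mem_filter_univ, mem_E] at *
    rw [map_div₀, div_eq_div_iff hy h, hx]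
    ring
  · intro e he
    simp only [mem_coe, mem_filter_univ, mem_E] at *
    rw [map_mul, he]
    ring
  · intro x _
    simp only
    field_simp
  · intro x _
    simp only
    field_simp

lemma card_three :
    (#{v : Fin 3 → F | ∑ i, v i * D.σ (v i) = 0 ∧ ∑ i, v i * D.bar (v i) = 0} : ℤ) =
    Fintype.card F + (Fintype.card F - 1) * #D.E := by
  have h1 : #{v : Fin 3 → F | ∑ i, v i * D.σ (v i) = 0 ∧ ∑ i, v i * D.bar (v i) = 0} =
      #((univ : Finset F).sigma fun y => {x : F | x * D.θ y = y * D.θ x}) := by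
    refine card_nbij (fun v => ⟨v 1, v 0⟩) ?_ ?_ ?_
    · intro v hv
      simp only [mem_coe, mem_filter_univ, Fin.sum_univ_three, mem_sigma, mem_univ,
        true_and] at *
      exact (D.norm_add_iff hv.1).1 hv.2
    · intro v hv w hw h
      simp only [mem_coe, mem_filter_univ, Fin.sum_univ_three, Sigma.mk.injEq, heq_eq_eq] at *
      obtain ⟨h1, h0⟩ := h
      have h2 : v 2 = w 2 := by
        apply D.g_inj
        have e1 := hv.1
        have e2 := hw.1
        rw [h0, h1] at e1
        linear_combination e1 - e2
      ext i
      fin_cases i <;> assumption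
    · rintro ⟨y, x⟩ h
      simp only [mem_coe, mem_filter_univ, mem_sigma, mem_univ, true_and] at h
      obtain ⟨z, hz⟩ := D.g_surj (x * D.σ x + y * D.σ y)
      have hz' : x * D.σ x + y * D.σ y + z * D.σ z = 0 := by grind
      refine ⟨![x, y, z], ?_, rfl⟩
      simpa [Fin.sum_univ_three] using ⟨hz', (D.norm_add_iff hz').2 h⟩
  rw [h1, card_sigma]
  simp only [card_parallel]
  rw [← add_sum_erase _ _ (mem_univ (0 : F)), if_pos rfl, sum_congr rfl
    (g := fun _ => #D.E) (fun y hy => if_neg (ne_of_mem_erase hy)), sum_const,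
    card_erase_of_mem (mem_univ _), card_univ, smul_eq_mul]
  push_cast [Nat.cast_sub (Fintype.card_pos (α := F))]
  ring

omit [Fintype F] in
/-- The polar form of the quadratic form in `S 1 b`. -/
lemma ψ_polar {b : F} (hb : D.bar b = b) (y w : F) :
    D.ψ (D.form b (y + w)) = D.ψ (D.form b y) * D.ψ (D.form b w) *
      D.ψ (D.σ y * (D.θ (D.θ w) + D.σ b * D.θ w + w)) := by
  have h1 : D.form b (y + w) = D.form b y + D.form b w + (y * D.σ w + w * D.σ y +
      D.ω * b * (y * D.bar w) + D.ω * b * (w * D.bar y)) := by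
    simp only [form, map_add]
    ring
  have h2 : D.ψ (y * D.σ w) = D.ψ (D.σ y * D.θ (D.θ w)) := by
    rw [← D.ψ_σ, map_mul, θ_θ]
  have h3 : D.ψ (D.ω * b * (w * D.bar y)) =
      D.ψ (D.ω * b * (y * D.bar w)) * D.ψ (b * (y * D.bar w)) := by
    rw [← D.ψ_bar, ← AddChar.map_add_eq_mul]
    simp only [map_mul, D.bar_bar, D.bar_ω, hb]
    congr 1
    ring
  have h4 : D.ψ (b * (y * D.bar w)) = D.ψ (D.σ y * (D.σ b * D.θ w)) := by
    rw [← D.ψ_σ, map_mul D.σ, map_mul D.σ, θ_apply]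
    congr 1
    ring
  rw [h1, mul_add, mul_add]
  simp only [AddChar.map_add_eq_mul]
  rw [h2, h3, h4, mul_comm w (D.σ y)]
  linear_combination D.ψ (D.form b y) * D.ψ (D.form b w) * D.ψ (D.σ y * D.θ (D.θ w)) *
    D.ψ (D.σ y * w) * D.ψ (D.σ y * (D.σ b * D.θ w)) * D.ψ_sq (D.ω * b * (y * D.bar w))

/-- The squared exponential sum is supported on the radical. -/
lemma S_sq {b : F} (hb : D.bar b = b) :
    D.S 1 b ^ 2 = Fintype.card F * ∑ w ∈ D.rad (D.σ b), D.ψ (D.form b w) := by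
  have hσ : Function.Bijective D.σ := Finite.injective_iff_bijective.1 D.σ.injective
  calc D.S 1 b ^ 2 = ∑ y, ∑ w, D.ψ (D.form b y) * D.ψ (D.form b (y + w)) := by
        simp only [S, one_mul, sq, sum_mul_sum]
        refine sum_congr rfl fun y _ => ?_
        exact (Fintype.sum_equiv (Equiv.addLeft y) _ _ fun w => rfl).symm
    _ = ∑ w, D.ψ (D.form b w) * ∑ y, D.ψ (y * (D.θ (D.θ w) + D.σ b * D.θ w + w)) := by
        rw [sum_comm]
        refine sum_congr rfl fun w _ => ?_
        have : ∀ y, D.ψ (D.form b y) * D.ψ (D.form b (y + w)) = D.ψ (D.form b w) *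
            D.ψ (D.σ y * (D.θ (D.θ w) + D.σ b * D.θ w + w)) := fun y => by
          rw [ψ_polar D hb, ← mul_assoc, ← mul_assoc, ← sq, ψ_sq, one_mul]
        simp only [this, ← mul_sum]
        congr 1
        exact Fintype.sum_bijective D.σ hσ _ _ fun y => rfl
    _ = ∑ w ∈ D.rad (D.σ b), D.ψ (D.form b w) * Fintype.card F := by
        simp only [sum_ψ, mul_ite, mul_zero]
        rw [rad, sum_filter]
        rfl
    _ = _ := by rw [← sum_mul, mul_comm]

lemma sum_rad_eq {b : F} (hb : D.bar b = b) :
    ∑ w ∈ D.rad (D.σ b), D.ψ (D.form b w) = 0 ∨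
      ∑ w ∈ D.rad (D.σ b), D.ψ (D.form b w) = #(D.rad (D.σ b)) := by
  by_cases h : ∀ w ∈ D.rad (D.σ b), D.ψ (D.form b w) = 1
  · right
    rw [sum_congr rfl h]
    simp
  push Not at h
  obtain ⟨w, hw, hne⟩ := h
  left
  rw [mem_rad] at hw
  have hsum : ∀ y, D.ψ (D.form b (y + w)) = D.ψ (D.form b w) * D.ψ (D.form b y) := by
    intro y
    rw [ψ_polar D hb, show D.θ (D.θ w) + D.σ b * D.θ w + w = 0 from hw, mul_zero,
      AddChar.map_zero_eq_one, mul_one, mul_comm]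
  have hshift : ∑ y ∈ D.rad (D.σ b), D.ψ (D.form b y) =
      D.ψ (D.form b w) * ∑ y ∈ D.rad (D.σ b), D.ψ (D.form b y) := by
    rw [mul_sum]
    refine sum_nbij' (fun y => y + w) (fun y => y + w) ?_ ?_ ?_ ?_ ?_
    · intro y hy
      rw [mem_rad] at *
      simpa using IsRad.mul_add_mul D hy hw (map_one _) (map_one _)
    · intro y hy
      rw [mem_rad] at *
      simpa using IsRad.mul_add_mul D hy hw (map_one _) (map_one _)
    · intro y _; grind
    · intro y _; grind
    · intro y _
      rw [hsum, ← mul_assoc, ← sq, ψ_sq, one_mul]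
  have : (D.ψ (D.form b w) - 1) * ∑ y ∈ D.rad (D.σ b), D.ψ (D.form b y) = 0 := by
    linear_combination -hshift
  exact (mul_eq_zero.1 this).resolve_left (sub_ne_zero.2 hne)

lemma zero_mem_rad (B : F) : (0 : F) ∈ D.rad B := by
  rw [mem_rad, IsRad]
  simp

/-- Either the radical is trivial and `S² = |F|`, or it has `|E|²` elements and
`S² ∈ {0, |F||E|²}`. -/
lemma S_sq_cases {b : F} (hb : D.bar b = b) :
    (#((D.rad (D.σ b)).erase 0) = 0 ∧ D.S 1 b ^ 2 = Fintype.card F) ∨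
      (#((D.rad (D.σ b)).erase 0) + 1 = #D.E ^ 2 ∧
        (D.S 1 b = 0 ∨ D.S 1 b ^ 2 = Fintype.card F * #D.E ^ 2)) := by
  by_cases h : ∃ y ∈ D.rad (D.σ b), y ≠ 0
  · right
    obtain ⟨y, hy, hy0⟩ := h
    have hcard := D.card_rad (by rw [← D.σ_bar, hb]) (D.mem_rad.1 hy) hy0
    refine ⟨by rw [card_erase_add_one (D.zero_mem_rad _), hcard], ?_⟩
    rw [S_sq D hb]
    rcases D.sum_rad_eq hb with h | h
    · left
      rw [← sq_eq_zero_iff, S_sq D hb, h, mul_zero]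
    · right
      rw [h, hcard, Nat.cast_pow]
  · left
    push Not at h
    have hr : D.rad (D.σ b) = {0} :=
      eq_singleton_iff_unique_mem.2 ⟨D.zero_mem_rad _, h⟩
    refine ⟨by simp [hr], ?_⟩
    rw [S_sq D hb, hr]
    simp [form]

lemma S_one_zero : D.S 1 0 = 0 := by
  have hg : Function.Bijective fun y => y * D.σ y :=
    Finite.injective_iff_bijective.1 fun x y h => D.g_inj x y h
  simp only [S, one_mul, mul_zero, zero_mul, add_zero]
  rw [Fintype.sum_bijective _ hg _ D.ψ fun y => rfl]
  exact AddChar.sum_eq_zero_of_ne_one D.ψ_ne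

/-- The number of nonzero parameters in `K` at which the exponential sum equals `v`. -/
noncomputable def count (v : ℤ) : ℕ := #{b ∈ D.K.erase 0 | D.S 1 b = v}

/-- The linear system satisfied by the counts determines them. -/
lemma solve_counts {q Q q' Z A B P M : ℤ} (hq : 1 < q) (hQ : 1 < Q) (hK : q = Q * q')
    (e0 : Z + 1 + A + B + P + M = q) (m0 : (Q ^ 2 - 1) * (Z + 1 + P + M) + 1 = q * Q)
    (m1 : (q ^ 2 - 1) * (A * q ^ 1 + B * (-q) ^ 1 + P * (q * Q) ^ 1 + M * (-(q * Q)) ^ 1) +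
      ((q ^ 2) ^ 1 + (q - 1) * (-q) ^ 1) = q ^ 2 * q * 1)
    (m2 : (q ^ 2 - 1) * (A * q ^ 2 + B * (-q) ^ 2 + P * (q * Q) ^ 2 + M * (-(q * Q)) ^ 2) +
      ((q ^ 2) ^ 2 + (q - 1) * (-q) ^ 2) = q ^ 2 * q * q ^ 2)
    (m3 : (q ^ 2 - 1) * (A * q ^ 3 + B * (-q) ^ 3 + P * (q * Q) ^ 3 + M * (-(q * Q)) ^ 3) +
      ((q ^ 2) ^ 3 + (q - 1) * (-q) ^ 3) = q ^ 2 * q * (q ^ 2 + (q ^ 2 - 1) * Q)) :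
    P = 0 ∧ Z = q' - 1 ∧ (Q + 1) * (2 * A) = Q * (q + 1) ∧
      (Q - 1) * (2 * B) = (Q - 2) * (q - 1) ∧ (Q ^ 2 - 1) * M = q' - 1 := by
  have hq0 : q ≠ 0 := by omega
  have hQ0 : Q ≠ 0 := by omega
  have hqs : q ^ 2 - 1 ≠ 0 := by nlinarith
  have hQs : Q ^ 2 - 1 ≠ 0 := by nlinarith
  have f1 : A - B + Q * (P - M) = 1 := by
    apply mul_left_cancel₀ (mul_ne_zero hqs hq0)
    linear_combination m1
  have f2 : A + B + Q ^ 2 * (P + M) = q - 1 := by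
    apply mul_left_cancel₀ (mul_ne_zero hqs (pow_ne_zero 2 hq0))
    linear_combination m2
  have f3 : A - B + Q ^ 3 * (P - M) = Q + 1 - q := by
    apply mul_left_cancel₀ (mul_ne_zero hqs (pow_ne_zero 3 hq0))
    linear_combination m3
  have g1 : (Q ^ 2 - 1) * (P - M) = 1 - q' := by
    apply mul_left_cancel₀ hQ0
    linear_combination f3 - f1 - hK
  have g2 : Z = (Q ^ 2 - 1) * (P + M) := by
    linear_combination e0 - f2
  have g3 : (Q ^ 2 - 1) * (P + M) = q' - 1 := by
    apply mul_left_cancel₀ (pow_ne_zero 2 hQ0)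
    linear_combination m0 - (Q ^ 2 - 1) * g2 + Q * hK
  have hP : P = 0 := by
    have : (Q ^ 2 - 1) * (2 * P) = 0 := by linear_combination g1 + g3
    have := (mul_eq_zero.1 this).resolve_left hQs
    omega
  subst hP
  refine ⟨rfl, ?_, ?_, ?_, ?_⟩
  · linear_combination g2 + g3
  · linear_combination (Q + 1) * (f1 + f2) - Q * g3 + hK
  · linear_combination (Q - 1) * (f2 - f1) - Q * g3 + hK
  · linear_combination g3

theorem distribution (q' : ℕ) (hE : 1 < #D.E) (hq' : 0 < q') (hK : #D.K = #D.E * q')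
    (hF : Fintype.card F = #D.K ^ 2) :
    (∀ b ∈ D.K, D.S 1 b = 0 ∨ D.S 1 b = #D.K ∨ D.S 1 b = -#D.K ∨
      D.S 1 b = -(#D.K * #D.E)) ∧
    (D.count 0 : ℤ) = q' - 1 ∧
    ((#D.E : ℤ) + 1) * (2 * D.count #D.K) = #D.E * (#D.K + 1) ∧
    ((#D.E : ℤ) - 1) * (2 * D.count (-#D.K)) = (#D.E - 2) * (#D.K - 1) ∧
    ((#D.E : ℤ) ^ 2 - 1) * D.count (-(#D.K * #D.E)) = q' - 1 := by
  have hK1 : 1 < #D.K := by rw [hK]; nlinarith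
  have m1 := D.moment 1
  have m2 := D.moment 2
  have m3 := D.moment 3
  have m0 := D.sum_card_rad_erase
  rw [D.S_zero_one hK1 hF, hF] at m1 m2 m3
  rw [card_one] at m1
  rw [card_two, hF] at m2
  rw [card_three, hF] at m3
  push_cast at m1 m2 m3
  have hcases := fun b (hb : b ∈ D.K) => D.S_sq_cases (D.mem_K.1 hb)
  simp only [hF, Nat.cast_pow, ← mul_pow, sq_eq_sq_iff_eq_or_eq_neg] at hcases
  have hKZ : (1 : ℤ) < #D.K := by exact_mod_cast hK1
  have hEZ : (1 : ℤ) < #D.E := by exact_mod_cast hE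
  zify at m0 hK
  have hcount : ∀ v, (D.count v : ℤ) + (if v = 0 then 1 else 0) =
      ∑ b ∈ D.K, if D.S 1 b = v then 1 else 0 := by
    intro v
    rw [← add_sum_erase _ _ D.zero_mem_K, S_one_zero, count, sum_boole, add_comm]
    simp only [eq_comm]
  set q : ℤ := ((#D.K : ℕ) : ℤ) with hq
  set Q : ℤ := ((#D.E : ℕ) : ℤ) with hQ
  have hqQ : q < q * Q := by nlinarith
  have hc0 := hcount 0
  have hcA := hcount q
  have hcB := hcount (-q)
  have hcP := hcount (q * Q)
  have hcM := hcount (-(q * Q))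
  rw [if_pos rfl] at hc0
  rw [if_neg (by omega), add_zero] at hcA hcB hcP hcM
  have hpow : ∀ b ∈ D.K, ∀ j : ℕ, j ≠ 0 → D.S 1 b ^ j =
      (if D.S 1 b = q then 1 else 0) * q ^ j + (if D.S 1 b = -q then 1 else 0) * (-q) ^ j +
      (if D.S 1 b = q * Q then 1 else 0) * (q * Q) ^ j +
      (if D.S 1 b = -(q * Q) then 1 else 0) * (-(q * Q)) ^ j := by
    intro b hb j hj
    rcases hcases b hb with ⟨-, h | h⟩ | ⟨-, h | h | h⟩ <;> rw [h]
    · rw [if_pos rfl, if_neg (by omega), if_neg (by omega), if_neg (by omega)]; ring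
    · rw [if_pos rfl, if_neg (by omega), if_neg (by omega), if_neg (by omega)]; ring
    · rw [if_neg (by omega), if_neg (by omega), if_neg (by omega), if_neg (by omega), zero_pow hj]
      ring
    · rw [if_pos rfl, if_neg (by omega), if_neg (by omega), if_neg (by omega)]; ring
    · rw [if_pos rfl, if_neg (by omega), if_neg (by omega), if_neg (by omega)]; ring
  have hrad : ∀ b ∈ D.K, (#((D.rad (D.σ b)).erase 0) : ℤ) = (Q ^ 2 - 1) *
      ((if D.S 1 b = 0 then 1 else 0) + (if D.S 1 b = q * Q then 1 else 0) +
        (if D.S 1 b = -(q * Q) then 1 else 0)) := by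
    intro b hb
    rcases hcases b hb with ⟨h', h | h⟩ | ⟨h', h | h | h⟩ <;> zify at h' <;> rw [h]
    · rw [if_neg (by omega), if_neg (by omega), if_neg (by omega), h']; ring
    · rw [if_neg (by omega), if_neg (by omega), if_neg (by omega), h']; ring
    · rw [if_pos rfl, if_neg (by omega), if_neg (by omega)]; linear_combination h'
    · rw [if_pos rfl, if_neg (by omega), if_neg (by omega)]; linear_combination h'
    · rw [if_pos rfl, if_neg (by omega), if_neg (by omega)]; linear_combination h'
  have hone : ∀ b ∈ D.K, (1 : ℤ) = (if D.S 1 b = 0 then 1 else 0) +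
      (if D.S 1 b = q then 1 else 0) + (if D.S 1 b = -q then 1 else 0) +
      (if D.S 1 b = q * Q then 1 else 0) + (if D.S 1 b = -(q * Q) then 1 else 0) := by
    intro b hb
    rcases hcases b hb with ⟨-, h | h⟩ | ⟨-, h | h | h⟩ <;> rw [h]
    · rw [if_pos rfl, if_neg (by omega), if_neg (by omega), if_neg (by omega), if_neg (by omega)]
      ring
    · rw [if_pos rfl, if_neg (by omega), if_neg (by omega), if_neg (by omega), if_neg (by omega)]
      ring
    · rw [if_pos rfl, if_neg (by omega), if_neg (by omega), if_neg (by omega), if_neg (by omega)]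
      ring
    · rw [if_pos rfl, if_neg (by omega), if_neg (by omega), if_neg (by omega), if_neg (by omega)]
      ring
    · rw [if_pos rfl, if_neg (by omega), if_neg (by omega), if_neg (by omega), if_neg (by omega)]
      ring
  have e0 : ∑ b ∈ D.K, (1 : ℤ) = q := by simp [hq]
  rw [sum_congr rfl hone] at e0
  rw [sum_congr rfl hrad] at m0
  rw [sum_congr rfl fun b hb => hpow b hb 1 one_ne_zero] at m1
  rw [sum_congr rfl fun b hb => hpow b hb 2 two_ne_zero] at m2
  rw [sum_congr rfl fun b hb => hpow b hb 3 three_ne_zero] at m3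
  simp only [sum_add_distrib, ← mul_sum, ← sum_mul, ← hc0, ← hcA, ← hcB, ← hcP, ← hcM]
    at e0 m0 m1 m2 m3
  have hPuniq : ∀ b ∈ D.K, D.count (q * Q) = 0 → D.S 1 b ≠ q * Q := by
    intro b hb h hS
    rw [h, Nat.cast_zero] at hcP
    have h1 := (sum_eq_zero_iff_of_nonneg (fun b _ => by split_ifs <;> norm_num)).1 hcP.symm b hb
    rw [if_pos hS] at h1
    exact one_ne_zero h1
  generalize hz : (D.count 0 : ℤ) = Z at *
  generalize (D.count q : ℤ) = A at *
  generalize (D.count (-q) : ℤ) = B at *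
  generalize hp : (D.count (q * Q) : ℤ) = P at *
  generalize (D.count (-(q * Q)) : ℤ) = M at *
  obtain ⟨hP, h⟩ := solve_counts hKZ hEZ hK e0 m0 m1 m2 m3
  refine ⟨fun b hb => ?_, h⟩
  have h1 := hPuniq b hb (by exact_mod_cast hp.trans hP)
  rcases hcases b hb with ⟨-, h | h⟩ | ⟨-, h | h | h⟩ <;> tauto

end

end FormData

section

variable {F : Type*} [Field F]

lemma pow_two_pow_eq_self_iff {x : F} (hx : x ≠ 0) (j : ℕ) :
    x ^ 2 ^ j = x ↔ x ^ (2 ^ j - 1) = 1 := by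
  have h : x ^ 2 ^ j = x ^ (2 ^ j - 1) * x := by
    rw [← pow_succ, Nat.sub_add_cancel Nat.one_le_two_pow]
  rw [h, mul_eq_right₀ hx]

open Classical in
lemma card_pow_two_pow_eq_self [Fintype F] {m : ℕ} (hF : Fintype.card F = 2 ^ m) (j : ℕ) :
    #{x : F | x ^ 2 ^ j = x} = 2 ^ m.gcd j := by
  have h1 := IsCyclic.card_powMonoidHom_ker Fˣ (2 ^ j - 1)
  rw [Nat.card_units, Nat.card_eq_fintype_card (α := F), hF, Nat.pow_sub_one_gcd_pow_sub_one] at h1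
  have h2 : #({x : F | x ^ 2 ^ j = x} : Finset F) - 1 = 2 ^ m.gcd j - 1 := by
    rw [← h1, Nat.card_eq_fintype_card, ← card_univ,
      ← card_erase_of_mem (a := (0 : F)) (by simp)]
    symm
    refine card_bij (fun u _ => ((u : Fˣ) : F)) ?_ ?_ ?_
    · rintro ⟨u, hu⟩ _
      simp only [mem_erase, mem_filter_univ]
      refine ⟨u.ne_zero, (pow_two_pow_eq_self_iff u.ne_zero j).2 ?_⟩
      rw [MonoidHom.mem_ker, powMonoidHom_apply] at hu
      rw [← Units.val_pow_eq_pow_val, hu, Units.val_one]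
    · intro u _ v _ h
      exact Subtype.ext (Units.ext h)
    · intro x hx
      simp only [mem_erase, mem_filter_univ] at hx
      refine ⟨⟨Units.mk0 x hx.1, ?_⟩, mem_univ _, rfl⟩
      rw [MonoidHom.mem_ker, powMonoidHom_apply]
      ext
      simpa using (pow_two_pow_eq_self_iff hx.1 j).1 hx.2
  have h3 : 0 < #({x : F | x ^ 2 ^ j = x} : Finset F) := card_pos.2 ⟨0, by simp⟩
  have h4 : 0 < 2 ^ m.gcd j := by positivity
  omega

lemma pow_eq_pow_of_modEq_of_fixed {x : F} {n a b : ℕ} (hx0 : x ≠ 0) (hx : x ^ 2 ^ n = x)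
    (h : a ≡ b [MOD 2 ^ n - 1]) : x ^ a = x ^ b :=
  pow_eq_pow_of_modEq h ((pow_two_pow_eq_self_iff hx0 n).1 hx)

variable [CharP F 2]

lemma trF_add (j : ℕ) (x y : F) : trF j (x + y) = trF j x + trF j y := by
  simp only [trF, add_pow_char_pow, sum_add_distrib]

lemma trF_pow (j i : ℕ) (x : F) : trF j (x ^ 2 ^ i) = trF j x ^ 2 ^ i := by
  rw [trF, trF, ← iterateFrobenius_def, ← iterateFrobenius_def, map_sum]
  simp only [map_pow]

lemma trF_sq {j : ℕ} {x : F} (hx : x ^ 2 ^ j = x) : trF j x ^ 2 = trF j x := by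
  have h1 := sum_range_succ (fun i => x ^ 2 ^ i) j
  rw [sum_range_succ', hx, pow_zero, pow_one] at h1
  have h2 := trF_pow j 1 x
  rw [pow_one] at h2
  rw [← h2, trF, trF, ← add_right_cancel h1]
  exact sum_congr rfl fun i _ => by rw [← pow_mul, ← pow_succ']

lemma trF_eq_zero_or_one {j : ℕ} {x : F} (hx : x ^ 2 ^ j = x) : trF j x = 0 ∨ trF j x = 1 := by
  have h : trF j x * (trF j x - 1) = 0 := by linear_combination trF_sq hx
  rcases mul_eq_zero.1 h with h | h
  · exact Or.inl h
  · exact Or.inr (sub_eq_zero.1 h)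

lemma trF_pow_of_fixed {j : ℕ} {x : F} (hx : x ^ 2 ^ j = x) (i : ℕ) :
    trF j (x ^ 2 ^ i) = trF j x := by
  rw [trF_pow]
  rcases trF_eq_zero_or_one hx with h | h <;> simp [h]

lemma trF_two_mul_mul {n : ℕ} {ω z : F} (hω : ω ^ 2 ^ n = ω + 1) (hz : z ^ 2 ^ n = z) :
    trF (2 * n) (ω * z) = trF n z := by
  have h1 : trF (2 * n) (ω * z) = trF n (ω * z) + trF n ((ω * z) ^ 2 ^ n) := by
    rw [two_mul]
    simp only [trF, sum_range_add, pow_add, pow_mul]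
  rw [h1, mul_pow, hω, hz, add_mul, one_mul, trF_add, ← add_assoc, CharTwo.add_self_eq_zero,
    zero_add]

lemma sgnF_add {a b : F} (ha : a = 0 ∨ a = 1) (hb : b = 0 ∨ b = 1) :
    sgnF (a + b) = sgnF a * sgnF b := by
  rcases ha with rfl | rfl <;> rcases hb with rfl | rfl <;>
    simp [sgnF, CharTwo.add_self_eq_zero]

/-- The additive character `x ↦ (-1) ^ tr_m(x)` of a field with `2 ^ m` elements. -/
noncomputable def traceChar (m : ℕ) (h : ∀ x : F, x ^ 2 ^ m = x) : AddChar F ℤ where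
  toFun x := sgnF (trF m x)
  map_zero_eq_one' := by simp [trF, sgnF]
  map_add_eq_mul' x y := by
    rw [trF_add, sgnF_add (trF_eq_zero_or_one (h x)) (trF_eq_zero_or_one (h y))]

lemma traceChar_apply (m : ℕ) (h : ∀ x : F, x ^ 2 ^ m = x) (x : F) :
    traceChar m h x = sgnF (trF m x) := rfl

lemma traceChar_ne_one [Fintype F] {m : ℕ} (hF : Fintype.card F = 2 ^ m)
    (h : ∀ x : F, x ^ 2 ^ m = x) : traceChar m h ≠ 1 := by
  let _ : Algebra (ZMod 2) F := ZMod.algebra F 2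
  have hm : Module.finrank (ZMod 2) F = m := by
    have := Module.card_eq_pow_finrank (K := ZMod 2) (V := F)
    rw [hF, ZMod.card] at this
    exact (Nat.pow_right_injective le_rfl this).symm
  obtain ⟨x, hx⟩ := Algebra.trace_surjective (ZMod 2) F 1
  have h1 := FiniteField.algebraMap_trace_eq_sum_pow (ZMod 2) F x
  rw [hx, hm, map_one, Nat.card_zmod] at h1
  intro h2
  have h3 := DFunLike.congr_fun h2 x
  rw [traceChar_apply, trF, ← h1, AddChar.one_apply] at h3
  simp [sgnF] at h3

end

section

variable {F : Type*} [Field F] [Fintype F]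

lemma bijOn_pow_generator {N : ℕ} (hF : Fintype.card F = N + 1) {α : F} (hα0 : α ≠ 0)
    (hα : ∀ x : F, x ≠ 0 → ∃ j : ℕ, α ^ j = x) :
    Set.BijOn (fun t => α ^ t) (range N) {x : F | x ≠ 0} := by
  classical
  have hN : 0 < N := by
    have := Fintype.one_lt_card (α := F)
    omega
  have h1 : α ^ N = 1 := by
    have := FiniteField.pow_card_sub_one_eq_one α hα0
    rwa [hF, Nat.add_sub_cancel] at this
  have hmaps : Set.MapsTo (fun t => α ^ t) (range N) {x : F | x ≠ 0} := fun t _ => pow_ne_zero t hα0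
  have hsurj : Set.SurjOn (fun t => α ^ t) (range N) {x : F | x ≠ 0} := by
    intro x hx
    obtain ⟨j, rfl⟩ := hα x hx
    exact ⟨j % N, by simpa using Nat.mod_lt _ hN, (pow_eq_pow_mod j h1).symm⟩
  refine ⟨hmaps, ?_, hsurj⟩
  have hcoe : {x : F | x ≠ 0} = ((univ.erase (0 : F) : Finset F) : Set F) := by ext; simp
  rw [hcoe] at hmaps hsurj
  refine injOn_of_surjOn_of_card_le _ hmaps hsurj ?_
  rw [card_range, card_erase_of_mem (mem_univ _), card_univ, hF, Nat.add_sub_cancel]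

end

section

variable {k r s n m l : ℕ}

lemma gcd_two_mul_eq (hn : n = k * r) (hm : m = 2 * n) (hl : l = k * s) (hse : Even s)
    (hrs : Nat.gcd r s = 1) : m.gcd l = 2 * k := by
  obtain ⟨t, rfl⟩ := hse
  have h1 : Nat.gcd r t = 1 := Nat.Coprime.coprime_dvd_right ⟨2, by ring⟩ hrs
  rw [hm, hn, hl, show 2 * (k * r) = 2 * k * r by ring, show k * (t + t) = 2 * k * t by ring,
    Nat.gcd_mul_left, h1, mul_one]

lemma gcd_two_mul_two_mul_eq (hn : n = k * r) (hm : m = 2 * n) (hl : l = k * s)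
    (hrs : Nat.gcd r s = 1) : m.gcd (2 * l) = 2 * k := by
  rw [hm, hn, hl, show 2 * (k * r) = 2 * k * r by ring, show 2 * (k * s) = 2 * k * s by ring,
    Nat.gcd_mul_left, hrs, mul_one]

lemma gcd_two_mul_add_eq (hn : n = k * r) (hm : m = 2 * n) (hl : l = k * s) (hro : Odd r)
    (hse : Even s) (hrs : Nat.gcd r s = 1) : m.gcd (l + n) = k := by
  have h1 : Nat.Coprime 2 (s + r) := Nat.coprime_two_left.2 (hse.add_odd hro)
  have h2 : Nat.Coprime r (s + r) := by simpa using hrs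
  rw [hm, hn, hl, show 2 * (k * r) = k * (2 * r) by ring, ← mul_add, Nat.gcd_mul_left,
    Nat.Coprime.mul_left h1 h2, mul_one]

open Classical in
lemma exists_formData (hk : 1 ≤ k) (hn : n = k * r) (hm : m = 2 * n) (hl : l = k * s)
    (hro : Odd r) (hse : Even s) (hrs : Nat.gcd r s = 1) {F : Type*} [Field F] [CharP F 2]
    [Fintype F] (hF : Fintype.card F = 2 ^ m) :
    ∃ D : FormData F, (∀ x, D.σ x = x ^ 2 ^ l) ∧ (∀ x, D.bar x = x ^ 2 ^ n) ∧
      ∀ x, D.ψ x = sgnF (trF m x) := by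
  have hpow : ∀ x : F, x ^ 2 ^ m = x := fun x => by rw [← hF, FiniteField.pow_card]
  have hnn : ∀ x : F, (x ^ 2 ^ n) ^ 2 ^ n = x := fun x => by
    rw [← pow_mul, ← pow_add, ← two_mul, ← hm, hpow]
  have hcomm : ∀ (x : F) (i j : ℕ), (x ^ 2 ^ i) ^ 2 ^ j = (x ^ 2 ^ j) ^ 2 ^ i :=
    fun x i j => by rw [← pow_mul, ← pow_mul, mul_comm]
  obtain ⟨ω, hωl, hωn⟩ : ∃ ω : F, ω ^ 2 ^ l = ω ∧ ω ^ 2 ^ n = ω + 1 := by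
    have hl' := card_pow_two_pow_eq_self hF l
    have hln := card_pow_two_pow_eq_self hF (l + n)
    rw [gcd_two_mul_eq hn hm hl hse hrs] at hl'
    rw [gcd_two_mul_add_eq hn hm hl hro hse hrs] at hln
    obtain ⟨v, hv, hvn⟩ : ∃ v : F, v ^ 2 ^ l = v ∧ v ^ 2 ^ n ≠ v := by
      by_contra! hcon
      have hsub : univ.filter (fun x : F => x ^ 2 ^ l = x) ⊆
          univ.filter (fun x : F => x ^ 2 ^ (l + n) = x) := by
        intro x hx
        rw [mem_filter_univ] at *
        rw [pow_add, pow_mul, hx, hcon x hx]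
      have := card_le_card hsub
      rw [hl', hln] at this
      have := (Nat.pow_le_pow_iff_right one_lt_two).1 this
      omega
    have he : v + v ^ 2 ^ n ≠ 0 := fun h => hvn (CharTwo.add_eq_zero.1 h).symm
    refine ⟨v / (v + v ^ 2 ^ n), ?_, ?_⟩
    · rw [div_pow, add_pow_char_pow, hcomm, hv]
    · rw [div_pow, add_pow_char_pow, hnn, add_comm (v ^ 2 ^ n), div_add_one he]
      congr 1
      rw [← add_assoc, CharTwo.add_self_eq_zero, zero_add]
  have hg : ∀ x y : F, x * x ^ 2 ^ l = y * y ^ 2 ^ l → x = y := by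
    have hll : univ.filter (fun x : F => x ^ 2 ^ l = x) =
        univ.filter (fun x : F => x ^ 2 ^ (2 * l) = x) := by
      refine eq_of_subset_of_card_le ?_ ?_
      · intro x hx
        rw [mem_filter_univ] at *
        rw [two_mul, pow_add, pow_mul, hx, hx]
      · rw [card_pow_two_pow_eq_self hF, card_pow_two_pow_eq_self hF,
          gcd_two_mul_eq hn hm hl hse hrs, gcd_two_mul_two_mul_eq hn hm hl hrs]
    have hone : ∀ x : F, x * x ^ 2 ^ l = 1 → x = 1 := by
      intro x hx
      have hx0 : x ≠ 0 := left_ne_zero_of_mul_eq_one hx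
      have h1 : x ^ 2 ^ l = x⁻¹ := eq_inv_of_mul_eq_one_right hx
      have h2 : x ∈ univ.filter (fun x : F => x ^ 2 ^ l = x) := by
        rw [hll, mem_filter_univ, two_mul, pow_add, pow_mul, h1, inv_pow, h1, inv_inv]
      rw [mem_filter_univ] at h2
      rw [h2] at hx
      have h3 : (x + 1) * (x + 1) = 0 := by grind
      exact CharTwo.add_eq_zero.1 (mul_self_eq_zero.1 h3)
    intro x y hxy
    by_cases hy : y = 0
    · subst hy
      simpa using hxy
    · have := hone (x / y) (by
        rw [div_pow, div_mul_div_comm, hxy, div_self (mul_ne_zero hy (pow_ne_zero _ hy))])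
      exact (div_eq_one_iff_eq hy).1 this
  have hθ : ∀ x : F, (fun z : F => (z ^ 2 ^ n) ^ 2 ^ l)^[r] x = x ^ 2 ^ n := by
    intro x
    have h1 : (fun z : F => (z ^ 2 ^ n) ^ 2 ^ l)^[r] x = x ^ 2 ^ (n * (r + s)) := by
      have : ∀ j, (fun z : F => (z ^ 2 ^ n) ^ 2 ^ l)^[j] x = x ^ 2 ^ ((n + l) * j) := by
        intro j
        induction j with
        | zero => simp
        | succ j ih =>
          rw [Function.iterate_succ_apply', ih]
          simp only [← pow_mul, ← pow_add]
          ring_nf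
      rw [this, hl, hn]
      ring_nf
    obtain ⟨t, ht⟩ := hro.add_even hse
    have h2 : ∀ t : ℕ, x ^ 2 ^ (n * (2 * t + 1)) = x ^ 2 ^ n := by
      intro t
      induction t with
      | zero => simp
      | succ t ih =>
        rw [show n * (2 * (t + 1) + 1) = n * (2 * t + 1) + n + n by ring, pow_add, pow_mul,
          pow_add, pow_mul, hnn, ih]
    rw [h1, ht, h2]
  refine ⟨⟨iterateFrobenius F 2 l, iterateFrobenius F 2 n, traceChar m hpow, ω, r,
    ?_, ?_, ?_, ?_, ?_, hro, ?_, ?_, ?_, traceChar_ne_one hF hpow⟩, ?_, ?_, fun x => rfl⟩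
  all_goals simp only [iterateFrobenius_def, traceChar_apply]
  · exact hnn
  · intro x; exact hcomm x n l
  · exact hωl
  · exact hωn
  · exact hg
  · exact hθ
  · intro x; rw [trF_pow_of_fixed (hpow x)]
  · intro x; rw [trF_pow_of_fixed (hpow x)]
  · exact fun _ => trivial
  · exact fun _ => trivial

end

section

variable {F : Type*} [Field F] [Fintype F] [CharP F 2] {n l d i : ℕ}

open scoped Classical

lemma crossCorr_eq_S_sub_one (D : FormData F) (hF : Fintype.card F = 2 ^ (2 * n))
    (hσ : ∀ x, D.σ x = x ^ 2 ^ l) (hbar : ∀ x, D.bar x = x ^ 2 ^ n)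
    (hψ : ∀ x, D.ψ x = sgnF (trF (2 * n) x)) {α : F} (hα0 : α ≠ 0)
    (hα : ∀ x : F, x ≠ 0 → ∃ j : ℕ, α ^ j = x) (hdi : d * (2 ^ l + 1) ≡ 2 ^ i [MOD 2 ^ n - 1])
    {c : F} (hc0 : c ≠ 0) (hc : D.bar c = c) {τ : ℕ} (hτ : c * D.σ c = (α ^ (2 ^ n + 1)) ^ τ) :
    crossCorr (2 * n) n d α τ = D.S 1 c - 1 := by
  have hbij := bijOn_pow_generator (N := 2 ^ (2 * n) - 1)
    (by rw [hF, Nat.sub_add_cancel Nat.one_le_two_pow]) hα0 hα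
  have hω : D.ω ^ 2 ^ n = D.ω + 1 := by rw [← hbar, D.bar_ω]
  let G : F → ℤ := fun x => sgnF (trF (2 * n) x + trF n ((x ^ (2 ^ n + 1) * (c * D.σ c)) ^ d))
  have h1 : crossCorr (2 * n) n d α τ = ∑ x ∈ univ.erase (0 : F), G x := by
    refine sum_nbij (fun t => α ^ t) (fun t _ => by simpa using pow_ne_zero t hα0) hbij.injOn
      (fun x hx => hbij.surjOn (by simpa using hx)) fun t _ => ?_
    simp only [G, hτ]
    congr 3
    ring
  have h2 : ∑ x ∈ univ.erase (0 : F), G x = ∑ y ∈ univ.erase (0 : F), G (y * D.σ y) := by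
    symm
    refine sum_nbij (fun y => y * D.σ y) ?_ (fun x _ y _ h => D.g_inj x y h) ?_ fun _ _ => rfl
    · intro y hy
      simpa using hy
    · intro x hx
      obtain ⟨y, rfl⟩ := D.g_surj x
      exact ⟨y, by simpa using hx, rfl⟩
  have h3 : ∀ y ∈ univ.erase (0 : F), G (y * D.σ y) =
      D.ψ (1 * (y * D.σ y) + D.ω * c * (y * D.bar y)) := by
    intro y hy
    have hy0 : y ≠ 0 := ne_of_mem_erase hy
    have hz0 : y * D.bar y * c ≠ 0 :=
      mul_ne_zero (mul_ne_zero hy0 ((map_ne_zero D.bar).2 hy0)) hc0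
    have hz : (y * D.bar y * c) ^ 2 ^ n = y * D.bar y * c := by
      rw [← hbar, map_mul, map_mul, D.bar_bar, hc]
      ring
    have hpow : ((y * D.σ y) ^ (2 ^ n + 1) * (c * D.σ c)) ^ d = (y * D.bar y * c) ^ 2 ^ i := by
      rw [← pow_eq_pow_of_modEq_of_fixed hz0 hz hdi]
      rw [mul_comm d, pow_mul]
      congr 1
      rw [hσ, hσ, hbar]
      ring
    simp only [G]
    rw [hpow, trF_pow_of_fixed hz, ← trF_two_mul_mul hω hz, ← trF_add, hψ]
    congr 2
    ring
  rw [h1, h2, sum_congr rfl h3, FormData.S, ← add_sum_erase _ _ (mem_univ (0 : F))]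
  simp

/-- Shifts of the cross correlation correspond to nonzero elements of the middle subfield. -/
lemma exists_bijOn_shift (D : FormData F) (hF : Fintype.card F = 2 ^ (2 * n))
    (hbar : ∀ x, D.bar x = x ^ 2 ^ n) (hK : #D.K = 2 ^ n) {α : F} (hα0 : α ≠ 0)
    (hα : ∀ x : F, x ≠ 0 → ∃ j : ℕ, α ^ j = x) :
    ∃ c : ℕ → F, (∀ τ, c τ * D.σ (c τ) = (α ^ (2 ^ n + 1)) ^ τ) ∧
      Set.BijOn c (range (2 ^ n - 1)) (D.K.erase 0) := by
  choose c hc using fun τ => D.g_surj ((α ^ (2 ^ n + 1)) ^ τ)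
  have hbij := bijOn_pow_generator (N := 2 ^ (2 * n) - 1)
    (by rw [hF, Nat.sub_add_cancel Nat.one_le_two_pow]) hα0 hα
  have hq : 2 ^ (2 * n) - 1 = (2 ^ n + 1) * (2 ^ n - 1) := by
    rw [mul_comm 2, pow_mul, ← Nat.sq_sub_sq, one_pow]
  have hβ : D.bar (α ^ (2 ^ n + 1)) = α ^ (2 ^ n + 1) := by
    have h : α ^ 2 ^ (2 * n) = α := by rw [← hF, FiniteField.pow_card]
    rw [hbar, ← pow_mul, add_mul, ← pow_add, ← two_mul, one_mul, pow_add, h, pow_succ']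
  have hmaps : Set.MapsTo c (range (2 ^ n - 1)) (D.K.erase 0) := by
    intro τ _
    rw [mem_coe, mem_erase, D.mem_K]
    constructor
    · intro h
      have := hc τ
      rw [h, zero_mul] at this
      exact pow_ne_zero _ (pow_ne_zero _ hα0) this.symm
    · refine D.g_inj _ _ ?_
      rw [D.σ_bar, ← map_mul, hc, map_pow, hβ]
  have hinj : Set.InjOn c (range (2 ^ n - 1)) := by
    intro τ hτ τ' hτ' h
    have h1 : (fun t => α ^ t) ((2 ^ n + 1) * τ) = (fun t => α ^ t) ((2 ^ n + 1) * τ') := by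
      simp only [pow_mul α (2 ^ n + 1)]
      rw [← hc, ← hc, h]
    have hlt : ∀ t ∈ (range (2 ^ n - 1) : Set ℕ),
        (2 ^ n + 1) * t ∈ (range (2 ^ (2 * n) - 1) : Set ℕ) := by
      intro t ht
      rw [mem_coe, mem_range] at *
      rw [hq]
      exact Nat.mul_lt_mul_of_pos_left ht (Nat.succ_pos _)
    exact Nat.eq_of_mul_eq_mul_left (Nat.succ_pos _) (hbij.injOn (hlt τ hτ) (hlt τ' hτ') h1)
  refine ⟨c, hc, hmaps, hinj, surjOn_of_injOn_of_card_le c hmaps hinj ?_⟩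
  rw [card_erase_of_mem D.zero_mem_K, hK, card_range]

lemma natCard_crossCorr_eq (D : FormData F) (hn : 0 < n) {α : F} {c : ℕ → F}
    (hc : Set.BijOn c (range (2 ^ n - 1)) (D.K.erase 0))
    (hS : ∀ τ ∈ range (2 ^ n - 1), crossCorr (2 * n) n d α τ = D.S 1 (c τ) - 1) (v : ℤ) :
    Nat.card {τ : ℕ | τ ≤ 2 ^ n - 2 ∧ crossCorr (2 * n) n d α τ = -1 + v} = D.count v := by
  have h2 : 2 ≤ 2 ^ n := Nat.le_self_pow hn.ne' 2
  have h : {τ : ℕ | τ ≤ 2 ^ n - 2 ∧ crossCorr (2 * n) n d α τ = -1 + v} =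
      ↑({τ ∈ range (2 ^ n - 1) | D.S 1 (c τ) = v} : Finset ℕ) := by
    ext τ
    rw [mem_coe, mem_filter, mem_range, Set.mem_ofPred_eq]
    have h3 : τ ≤ 2 ^ n - 2 ↔ τ < 2 ^ n - 1 := by omega
    rw [h3]
    refine and_congr_right fun hτ => ?_
    rw [hS τ (mem_range.2 hτ)]
    constructor <;> intro h <;> linarith
  rw [h, Nat.card_coe_set_eq, Set.ncard_coe_finset, FormData.count]
  refine card_nbij c ?_ ?_ ?_
  · intro τ hτ
    rw [mem_coe, mem_filter] at *
    exact ⟨hc.mapsTo hτ.1, hτ.2⟩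
  · exact hc.injOn.mono fun τ hτ => (mem_filter.1 hτ).1
  · intro b hb
    rw [mem_coe, mem_filter] at hb
    obtain ⟨τ, hτ, rfl⟩ := hc.surjOn hb.1
    exact ⟨τ, mem_coe.2 (mem_filter.2 ⟨hτ, hb.2⟩), rfl⟩

end

/-- distribution of the cross correlation. With the standing notation
(`n = kr`, `m = 2n`, `l = ks`, …), let `d > 0` satisfy `d·(2^l+1) ≡ 2^i (mod 2^n−1)`.
Then every value `C_d(τ)` (for `0 ≤ τ ≤ 2^n−2`) lies in
`{−1, −1+2^n, −1−2^n, −1−2^{n+k}}`, with occurrence counts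
`#(−1) = 2^{n−k} − 1`, `(2^k+1)·#(−1+2^n) = 2^{k−1}(2^n+1)`,
`(2^k−1)·#(−1−2^n) = (2^{k−1}−1)(2^n−1)`, `(2^{2k}−1)·#(−1−2^{n+k}) = 2^{n−k} − 1`;
in particular the value `−1+2^{n+k}` never occurs. -/
theorem crossCorr_distribution
    (k r s n m l : ℕ) (hk : 1 ≤ k) (hr : 3 ≤ r) (hro : Odd r)
    (hn : n = k * r) (hm : m = 2 * n) (hl : l = k * s)
    (hse : Even s) (hs0 : 0 < s) (hsr : s < r) (hrs : Nat.gcd r s = 1)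
    (F : Type) [Field F] [Fintype F] (hF : Fintype.card F = 2 ^ m)
    (α : F) (hα0 : α ≠ 0) (hα : ∀ x : F, x ≠ 0 → ∃ j : ℕ, α ^ j = x)
    (d i : ℕ) (hd : 0 < d)
    (hdi : d * (2 ^ l + 1) ≡ 2 ^ i [MOD 2 ^ n - 1]) :
    (∀ τ : ℕ, τ ≤ 2 ^ n - 2 →
        crossCorr m n d α τ
          ∈ ({-1, -1 + 2 ^ n, -1 - 2 ^ n, -1 - 2 ^ (n + k)} : Set ℤ)) ∧
    Nat.card {τ : ℕ | τ ≤ 2 ^ n - 2 ∧ crossCorr m n d α τ = -1}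
      = 2 ^ (n - k) - 1 ∧
    (2 ^ k + 1) *
        Nat.card {τ : ℕ | τ ≤ 2 ^ n - 2 ∧ crossCorr m n d α τ = -1 + 2 ^ n}
      = 2 ^ (k - 1) * (2 ^ n + 1) ∧
    (2 ^ k - 1) *
        Nat.card {τ : ℕ | τ ≤ 2 ^ n - 2 ∧ crossCorr m n d α τ = -1 - 2 ^ n}
      = (2 ^ (k - 1) - 1) * (2 ^ n - 1) ∧
    (2 ^ (2 * k) - 1) *
        Nat.card {τ : ℕ | τ ≤ 2 ^ n - 2 ∧ crossCorr m n d α τ = -1 - 2 ^ (n + k)}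
      = 2 ^ (n - k) - 1 ∧
    (∀ τ : ℕ, τ ≤ 2 ^ n - 2 → crossCorr m n d α τ ≠ -1 + 2 ^ (n + k)) := by
  classical
  subst hm
  have hn0 : 0 < n := by rw [hn]; positivity
  have hkn : k ≤ n := by rw [hn]; exact Nat.le_mul_of_pos_right k (by omega)
  have hchar : CharP F 2 := by
    have : Fact (Nat.Prime 2) := ⟨Nat.prime_two⟩
    exact charP_of_card_eq_prime_pow hF
  obtain ⟨D, hσ, hbar, hψ⟩ := exists_formData hk hn rfl hl hro hse hrs hF
  have hK : #D.K = 2 ^ n := by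
    have h := card_pow_two_pow_eq_self hF n
    rw [Nat.gcd_eq_right (dvd_mul_left n 2)] at h
    rw [← h]
    exact congrArg card (by ext x; rw [D.mem_K, mem_filter_univ, hbar])
  have hE : #D.E = 2 ^ k := by
    have h := card_pow_two_pow_eq_self hF (l + n)
    rw [gcd_two_mul_add_eq hn rfl hl hro hse hrs] at h
    rw [← h]
    refine congrArg card ?_
    ext x
    rw [D.mem_E, D.θ_apply, mem_filter_univ, hσ, hbar, ← pow_mul, ← pow_add, add_comm n]
  obtain ⟨c, hcτ, hc⟩ := exists_bijOn_shift D hF hbar hK hα0 hα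
  have hcK : ∀ τ ∈ range (2 ^ n - 1), c τ ≠ 0 ∧ c τ ∈ D.K := fun τ hτ =>
    mem_erase.1 (hc.mapsTo hτ)
  have hS : ∀ τ ∈ range (2 ^ n - 1), crossCorr (2 * n) n d α τ = D.S 1 (c τ) - 1 := fun τ hτ =>
    crossCorr_eq_S_sub_one D hF hσ hbar hψ hα0 hα hdi (hcK τ hτ).1 (D.mem_K.1 (hcK τ hτ).2)
      (hcτ τ)
  have hcard := natCard_crossCorr_eq D hn0 hc hS
  have hQ2 : (2 : ℤ) ^ k = 2 * 2 ^ (k - 1) := by rw [← pow_succ', Nat.sub_add_cancel hk]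
  have hQ1 : (1 : ℤ) ≤ 2 ^ (k - 1) := one_le_pow₀ one_le_two
  have hq1 : (1 : ℤ) ≤ 2 ^ n := one_le_pow₀ one_le_two
  have hnk : (2 : ℤ) ^ (n + k) = 2 ^ n * 2 ^ k := pow_add _ _ _
  obtain ⟨hval, h0, h1, h2, h3⟩ := D.distribution (2 ^ (n - k))
    (by rw [hE]; exact Nat.one_lt_two_pow (by omega)) (by positivity)
    (by rw [hK, hE, ← pow_add, Nat.add_sub_cancel' hkn]) (by rw [hF, hK, ← pow_mul, mul_comm])
  rw [hK, hE] at hval h1 h2 h3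
  push_cast at hval h0 h1 h2 h3
  have hmem : ∀ τ : ℕ, τ ≤ 2 ^ n - 2 → τ ∈ range (2 ^ n - 1) := fun τ hτ => by
    have : 2 ≤ 2 ^ n := Nat.le_self_pow hn0.ne' 2
    rw [mem_range]
    omega
  refine ⟨fun τ hτ => ?_, ?_, ?_, ?_, ?_, fun τ hτ h => ?_⟩
  · rw [hS τ (hmem τ hτ), hnk]
    rcases hval _ (hcK τ (hmem τ hτ)).2 with h | h | h | h <;> rw [h]
    · exact Or.inl (by ring)
    · exact Or.inr (Or.inl (by ring))
    · exact Or.inr (Or.inr (Or.inl (by ring)))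
    · exact Or.inr (Or.inr (Or.inr (by rw [Set.mem_singleton_iff]; ring)))
  · have := hcard 0
    rw [add_zero] at this
    rw [this]
    zify [Nat.one_le_two_pow (n := n - k)]
    exact h0
  · rw [hcard]
    zify
    rw [hQ2] at h1 ⊢
    linarith
  · simp only [sub_eq_add_neg (-1 : ℤ)]
    rw [hcard]
    zify [Nat.one_le_two_pow (n := n), Nat.one_le_two_pow (n := k),
      Nat.one_le_two_pow (n := k - 1)]
    rw [hQ2] at h2 ⊢
    linarith
  · simp only [sub_eq_add_neg (-1 : ℤ)]
    rw [hcard, hnk]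
    zify [Nat.one_le_two_pow (n := n - k), Nat.one_le_two_pow (n := 2 * k)]
    rw [mul_comm 2 k, pow_mul]
    exact h3
  · have hle : (2 : ℤ) ^ n ≤ 2 ^ n * 2 ^ (k - 1) := le_mul_of_one_le_right (by positivity) hQ1
    rw [hS τ (hmem τ hτ), hnk, hQ2, mul_left_comm] at h
    rcases hval _ (hcK τ (hmem τ hτ)).2 with h' | h' | h' | h' <;> rw [h'] at h
    · linarith
    · linarith
    · linarith
    · rw [hQ2, mul_left_comm] at h
      linarith
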